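/- arXiv:1701.00531 — 12 statements merged into one kernel-verified Lean document; each statement's English description precedes it below -/
import Mathlib

section
/- Let g ≥ 2 be an integer and let A be the g×g matrix over the field 𝔽₂ with two elements given by the block sum of [[0,1],[1,0]] and the identity matrix I_{g−2} (i.e., the permutation matrix interchanging the first two standard basis vectors). Then there is no g×g matrix P over 𝔽₂ satisfying Pᵀ·P = I_g and P·P = A. -/
open Matrix

/-- A transposition matrix is not the square of an orthogonal matrix. -/
theorem not_exists_orthogonal_sq_eq_permMatrix_swap {n R : Type*} [Fintype n] [DecidableEq n]
    [CommRing R] [Nontrivial R] {a b : n} (hab : a ≠ b) :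
    ¬ ∃ P : Matrix n n R, Pᵀ * P = 1 ∧ P * P = (Equiv.swap a b).permMatrix R := by
  rintro ⟨P, hP, hsq⟩
  have left_mul (M : Matrix n n R) (i j : n) :
      (P * P * M) i j = M (Equiv.swap a b i) j := by
    simp [hsq, PEquiv.toMatrix_toPEquiv_mul]
  have mul_right (M : Matrix n n R) (i j : n) :
      (M * (P * P)) i j = M i (Equiv.swap a b j) := by
    simp [hsq, PEquiv.mul_toMatrix_toPEquiv]
  have hT : Pᵀ * (P * P) = P := by rw [← mul_assoc, hP, one_mul]
  have hcomm (i j : n) : P (Equiv.swap a b i) j = P i (Equiv.swap a b j) := by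
    rw [← left_mul P, ← mul_right P, mul_assoc]
  have h_diag : P b a = P a a := by
    have := mul_right Pᵀ a a
    rw [hT] at this
    simpa using this.symm
  have h_col (i : n) : P i a = P i b := by
    have haa : P b a = P a b := by simpa using hcomm a a
    have hba : P a a = P b b := by simpa using hcomm b a
    rcases eq_or_ne i a with rfl | hia
    · rw [← haa, h_diag]
    rcases eq_or_ne i b with rfl | hib
    · rw [← hba, h_diag]
    · simpa [Equiv.swap_apply_of_ne_of_ne hia hib] using hcomm i a
  have h_one : (Pᵀ * P) a a = (Pᵀ * P) a b := by simp only [mul_apply, h_col]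
  simp [hP, hab] at h_one

/-- The image under the homology representation of the Dehn twist `t_{a₁}`:
the block sum of `[[0,1],[1,0]]` and the identity `I_{g-2}`, i.e. the
permutation matrix interchanging the first two standard basis vectors. -/
theorem no_sqrt_of_twist_typeA (g : ℕ) (hg : 2 ≤ g)
    (A : Matrix (Fin g) (Fin g) (ZMod 2))
    (hA : ∀ i j : Fin g, A i j =
      if ((i : ℕ) = 0 ∧ (j : ℕ) = 1) ∨ ((i : ℕ) = 1 ∧ (j : ℕ) = 0) ∨
          (i = j ∧ 2 ≤ (i : ℕ)) then 1 else 0) :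
    ¬ ∃ P : Matrix (Fin g) (Fin g) (ZMod 2), Pᵀ * P = 1 ∧ P * P = A := by
  have hA' : A = (Equiv.swap (⟨0, by lia⟩ : Fin g) ⟨1, by lia⟩).permMatrix (ZMod 2) := by
    ext i j
    rw [hA, Equiv.Perm.permMatrix, PEquiv.toMatrix_apply]
    simp only [Equiv.toPEquiv_apply, Option.mem_def, Option.some.injEq, Equiv.swap_apply_def,
      Fin.ext_iff]
    congr 1
    grind
  rw [hA']
  exact not_exists_orthogonal_sq_eq_permMatrix_swap (by simp)
end

section
/- Let g ≥ 2 be an even integer and let B = I_g + J_g be the g×g matrix over the field 𝔽₂ with two elements, where J_g is the all-ones matrix. Then there is no g×g matrix R over 𝔽₂ satisfying Rᵀ·R = I_g and R·R = B. -/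
open Matrix

/-- Over `𝔽₂`, every column of an orthogonal matrix sums to `1`. -/
theorem sum_col_eq_one_of_transpose_mul_self {n : Type*} [Fintype n] [DecidableEq n]
    {R : Matrix n n (ZMod 2)} (hR : Rᵀ * R = 1) (j : n) : ∑ i, R i j = 1 := by
  have idem : ∀ x : ZMod 2, x * x = x := by decide
  simpa [Matrix.mul_apply, idem] using congrFun (congrFun hR j) j

/-- For even `g`, the matrix `B = I_g + J_g` over `𝔽₂` (with `J_g` the all-ones
matrix) has no square root `R` satisfying `Rᵀ·R = I_g`. -/
theorem no_sqrt_of_twist_typeB (g : ℕ) (hg : 2 ≤ g) (hge : Even g) :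
    ¬ ∃ R : Matrix (Fin g) (Fin g) (ZMod 2),
      Rᵀ * R = 1 ∧ R * R = 1 + Matrix.of (fun _ _ => (1 : ZMod 2)) := by
  rintro ⟨R, hR, hsq⟩
  have key : R = Rᵀ + Rᵀ * Matrix.of (fun _ _ => (1 : ZMod 2)) := by
    calc R = Rᵀ * (R * R) := by rw [← Matrix.mul_assoc, hR, Matrix.one_mul]
      _ = _ := by rw [hsq, Matrix.mul_add, Matrix.mul_one]
  let i : Fin g := ⟨0, by omega⟩
  have hdiag := congrFun (congrFun key i) i
  simp [Matrix.mul_apply, sum_col_eq_one_of_transpose_mul_self hR] at hdiag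
end

section
/- Let g ≥ 3 be an odd integer. Then g is the maximal degree among data sets of type A of genus g: there exists a data set of type A of genus g and degree n = g, and every data set of type A of genus g has degree n ≤ g. -/
/-- A data set of type A (degree `n`), as in Parlak–Stukow:
conditions (D1), (D2), (D3A). -/
structure DataSetA where
  n : ℤ
  g0 : ℤ
  a : ℤ
  b : ℤ
  m : ℕ
  c : Fin m → ℤ
  ni : Fin m → ℤ
  /-- (D1): `n > 1` is odd -/
  n_gt_one : 1 < n
  n_odd : Odd n
  /-- (D1): each `nᵢ > 1` -/
  ni_gt_one : ∀ i, 1 < ni i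
  /-- (D1): each `nᵢ` divides `n` -/
  ni_dvd : ∀ i, ni i ∣ n
  /-- (D2) -/
  gcd_a : Int.gcd a n = 1
  gcd_b : Int.gcd b n = 1
  gcd_c : ∀ i, Int.gcd (c i) (ni i) = 1
  /-- (D3A): `g₀ ≥ 1` -/
  g0_pos : 1 ≤ g0
  /-- (D3A): `b ± a = ab mod n` -/
  D3A : b + a ≡ a * b [ZMOD n] ∨ b - a ≡ a * b [ZMOD n]

/-- The genus of a type A data set: `g = g₀·n + Σᵢ (n/nᵢ)(nᵢ − 1)`. -/
def DataSetA.genus (D : DataSetA) : ℤ :=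
  D.g0 * D.n + ∑ i, (D.n / D.ni i) * (D.ni i - 1)

/-- For odd `g ≥ 3`, the maximal degree among type A data sets of genus `g`
is `g` itself. -/
theorem typeA_max_degree_odd_genus (g : ℤ) (hg : 3 ≤ g) (hodd : Odd g) :
    (∃ D : DataSetA, D.genus = g ∧ D.n = g) ∧
      ∀ D : DataSetA, D.genus = g → D.n ≤ g := by
  refine ⟨⟨⟨g, 1, 2, 2, 0, Fin.elim0, Fin.elim0, by linarith, hodd, fun i => i.elim0,
    fun i => i.elim0, ?_, ?_, fun i => i.elim0, le_rfl, Or.inl rfl⟩, ?_, rfl⟩, ?_⟩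
  · exact Int.isCoprime_iff_gcd_eq_one.mp (Int.isCoprime_two_left.mpr hodd)
  · exact Int.isCoprime_iff_gcd_eq_one.mp (Int.isCoprime_two_left.mpr hodd)
  · simp [DataSetA.genus]
  · intro D hD
    have hn := D.n_gt_one
    have hsum : 0 ≤ ∑ i, (D.n / D.ni i) * (D.ni i - 1) := by
      refine Finset.sum_nonneg fun i _ => ?_
      have hi := D.ni_gt_one i
      exact mul_nonneg (Int.ediv_nonneg (by linarith) (by linarith)) (by linarith)
    have hg0 : D.n ≤ D.g0 * D.n := le_mul_of_one_le_left (by linarith) D.g0_pos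
    rw [← hD, DataSetA.genus]
    linarith
end

section
/- Let g = 2^l·k₁·k₂ where l ≥ 2 is an even integer, k₁, k₂ ≥ 1 are odd integers with 2^l·k₁ + 1 ≡ 0 (mod 3), and k₁ is the smallest positive odd integer s dividing g/2^l such that 2^l·s + 1 ≡ 0 (mod 3). Then the maximal degree among data sets of type A of genus g equals (2^l·k₁ + 1)·k₂/3: there exists a data set of type A of genus g of this degree, and every data set of type A of genus g has degree at most (2^l·k₁ + 1)·k₂/3. In particular g/2 > (2^l·k₁+1)k₂/3 > g/3. -/
theorem Int.odd_of_dvd {a b : ℤ} (hb : Odd b) (h : a ∣ b) : Odd a := by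
  obtain ⟨c, rfl⟩ := h
  exact (Int.odd_mul.mp hb).1

/-- The contribution of a single cone point to the genus is even. -/
theorem DataSetA.even_term (D : DataSetA) (i : Fin D.m) :
    Even ((D.n / D.ni i) * (D.ni i - 1)) :=
  ((Int.odd_of_dvd D.n_odd (D.ni_dvd i)).sub_odd odd_one).mul_left _

/-- The contribution of a single cone point to the genus is at least `2n/3`. -/
theorem DataSetA.two_mul_n_le_term (D : DataSetA) (i : Fin D.m) :
    2 * D.n ≤ 3 * ((D.n / D.ni i) * (D.ni i - 1)) := by
  have hgt := D.ni_gt_one i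
  have hn := D.n_gt_one
  obtain ⟨t, ht⟩ := Int.odd_of_dvd D.n_odd (D.ni_dvd i)
  have he : D.ni i * (D.n / D.ni i) = D.n := Int.mul_ediv_cancel' (D.ni_dvd i)
  have hpos : 0 < D.n / D.ni i := by
    by_contra! h
    nlinarith
  have h3 : 3 ≤ D.ni i := by omega
  nlinarith

theorem DataSetA.two_mul_m_mul_n_le (D : DataSetA) :
    D.m * (2 * D.n) ≤ 3 * ∑ i, (D.n / D.ni i) * (D.ni i - 1) := by
  rw [Finset.mul_sum]
  simpa using Finset.card_nsmul_le_sum Finset.univ _ _ fun i _ => D.two_mul_n_le_term i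

theorem DataSetA.even_g0_of_even_genus (D : DataSetA) (h : Even D.genus) : Even D.g0 := by
  have hsum : Even (∑ i, (D.n / D.ni i) * (D.ni i - 1)) :=
    Finset.even_sum _ fun i _ => D.even_term i
  unfold DataSetA.genus at h
  rw [Int.even_add, iff_true_right hsum, Int.even_mul] at h
  exact h.resolve_right (Int.not_even_iff_odd.mpr D.n_odd)

/-- A type A data set with genus divisible by 4 and less than three times the degree has
`g₀ = 2` and exactly one cone point. -/
theorem DataSetA.exists_genus_eq_of_genus_lt (D : DataSetA) (h4 : 4 ∣ D.genus)
    (h : D.genus < 3 * D.n) :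
    ∃ d q : ℤ, 0 < d ∧ D.n = d * q ∧ D.genus = d * (3 * q - 1) := by
  have hn := D.n_gt_one
  have hsum := D.two_mul_m_mul_n_le
  obtain ⟨r, hr⟩ := D.even_g0_of_even_genus (even_iff_two_dvd.mpr (by omega))
  have hg0 := D.g0_pos
  have hgen : D.genus = D.g0 * D.n + ∑ i, (D.n / D.ni i) * (D.ni i - 1) := rfl
  have hSnonneg : 0 ≤ ∑ i, (D.n / D.ni i) * (D.ni i - 1) := by
    have : 0 ≤ D.m * (2 * D.n) := by positivity
    linarith
  have hg0' : D.g0 = 2 := by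
    have : D.g0 < 3 := by
      by_contra! hc
      nlinarith
    omega
  rw [hg0'] at hgen
  have hm : D.m = 1 := by
    have hlt : D.m < 2 := by
      by_contra! hc
      have : (2 : ℤ) ≤ D.m := by exact_mod_cast hc
      nlinarith
    have hne : D.m ≠ 0 := by
      intro h0
      have : ∑ i, (D.n / D.ni i) * (D.ni i - 1) = 0 :=
        Finset.sum_eq_zero fun i _ => absurd i.2 (by omega)
      obtain ⟨t, ht⟩ := D.n_odd
      omega
    omega
  have hval : ∃ i : Fin D.m,
      ∑ i, (D.n / D.ni i) * (D.ni i - 1) = (D.n / D.ni i) * (D.ni i - 1) := by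
    have : Subsingleton (Fin D.m) := by rw [hm]; infer_instance
    exact ⟨⟨0, by omega⟩, Fintype.sum_subsingleton _ _⟩
  obtain ⟨i, hi⟩ := hval
  have he : D.ni i * (D.n / D.ni i) = D.n := Int.mul_ediv_cancel' (D.ni_dvd i)
  have hgt := D.ni_gt_one i
  refine ⟨D.n / D.ni i, D.ni i, ?_, by linarith, by rw [hgen, hi]; linarith⟩
  by_contra! hc
  nlinarith

/-- For odd `q > 1` and odd `d ≥ 1` there is a type A data set of degree `d * q` with `g₀ = 2`
and a single cone point of order `q`. -/
theorem exists_dataSetA_genus_eq {d q : ℤ} (hd : 1 ≤ d) (hdodd : Odd d) (hq : 1 < q)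
    (hqodd : Odd q) : ∃ D : DataSetA, D.genus = d * (3 * q - 1) ∧ D.n = d * q := by
  have hcop : Int.gcd 2 (d * q) = 1 :=
    Int.isCoprime_iff_gcd_eq_one.mp (Int.isCoprime_two_left.mpr (hdodd.mul hqodd))
  refine ⟨{ n := d * q, g0 := 2, a := 2, b := 2, m := 1, c := fun _ => 1, ni := fun _ => q
            n_gt_one := by nlinarith
            n_odd := hdodd.mul hqodd
            ni_gt_one := fun _ => hq
            ni_dvd := fun _ => Dvd.intro_left d rfl
            gcd_a := hcop
            gcd_b := hcop
            gcd_c := fun _ => by simp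
            g0_pos := by norm_num
            D3A := Or.inl rfl }, ?_, rfl⟩
  have hdiv : d * q / q = d := Int.mul_ediv_cancel d (by omega)
  simp only [DataSetA.genus, Finset.univ_unique, Finset.sum_singleton, hdiv]
  ring


/-- For `g = 2^l·k₁·k₂` with `l ≥ 2` even, `k₁, k₂ ≥ 1` odd,
`2^l·k₁ + 1 ≡ 0 (mod 3)` and `k₁` minimal with these properties, the maximal
degree among type A data sets of genus `g` is `N = (2^l·k₁ + 1)·k₂/3`;
moreover `g/2 > N > g/3`. -/
theorem typeA_max_degree_two_pow_even (l : ℕ) (k₁ k₂ : ℤ)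
    (hl : 2 ≤ l) (hleven : Even l)
    (hk₁ : 1 ≤ k₁) (hk₁odd : Odd k₁) (hk₂ : 1 ≤ k₂) (hk₂odd : Odd k₂)
    (hmod : (3 : ℤ) ∣ 2 ^ l * k₁ + 1)
    (hmin : ∀ s : ℤ, 1 ≤ s → Odd s → s ∣ k₁ * k₂ →
      (3 : ℤ) ∣ 2 ^ l * s + 1 → k₁ ≤ s) :
    ∃ N : ℤ, 3 * N = (2 ^ l * k₁ + 1) * k₂ ∧
      (∃ D : DataSetA, D.genus = 2 ^ l * k₁ * k₂ ∧ D.n = N) ∧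
      (∀ D : DataSetA, D.genus = 2 ^ l * k₁ * k₂ → D.n ≤ N) ∧
      2 * N < 2 ^ l * k₁ * k₂ ∧ 2 ^ l * k₁ * k₂ < 3 * N := by
  obtain ⟨q, hq⟩ := hmod
  have h4 : (4 : ℤ) ∣ 2 ^ l := by simpa using pow_dvd_pow (2 : ℤ) hl
  have hpow : (4 : ℤ) ≤ 2 ^ l := Int.le_of_dvd (by positivity) h4
  have hg : 4 * k₂ ≤ 2 ^ l * k₁ * k₂ := by
    have : 4 ≤ 2 ^ l * k₁ := by nlinarith
    nlinarith
  have h3N : 3 * (k₂ * q) = 2 ^ l * k₁ * k₂ + k₂ := by linear_combination -k₂ * hq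
  have hq1 : 1 < q := by nlinarith
  have hqodd : Odd q := by
    obtain ⟨t, ht⟩ := h4.mul_right k₁
    rw [Int.odd_iff]
    omega
  refine ⟨k₂ * q, by rw [h3N]; ring, ?_, ?_, by linarith, by linarith⟩
  · obtain ⟨D, hD, hDn⟩ := exists_dataSetA_genus_eq hk₂ hk₂odd hq1 hqodd
    exact ⟨D, by rw [hD]; linear_combination -k₂ * hq, hDn⟩
  · intro D hD
    rcases le_or_gt (3 * D.n) D.genus with hle | hlt
    · linarith
    obtain ⟨d, r, hd, hn, hgen⟩ :=
      D.exists_genus_eq_of_genus_lt (hD ▸ (h4.mul_right _).mul_right _) hlt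
    have hdodd : Odd d := Int.odd_of_dvd D.n_odd ⟨r, hn⟩
    have heq : 2 ^ l * (k₁ * k₂) = d * (3 * r - 1) := by rw [← hgen, hD]; ring
    have hcop : IsCoprime ((2 : ℤ) ^ l) d := (Int.isCoprime_two_left.mpr hdodd).pow_left
    obtain ⟨s, hs⟩ : d ∣ k₁ * k₂ := hcop.symm.dvd_of_dvd_mul_left ⟨_, heq⟩
    have hsr : 2 ^ l * s = 3 * r - 1 := by
      apply mul_left_cancel₀ hd.ne'
      rw [← heq, hs]
      ring
    have hspos : 0 < s := by
      have : 0 < d * s := by rw [← hs]; positivity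
      exact pos_of_mul_pos_right this hd.le
    have hsdvd : s ∣ k₁ * k₂ := ⟨d, by rw [hs]; ring⟩
    have hks : k₁ ≤ s :=
      hmin s hspos (Int.odd_of_dvd (hk₁odd.mul hk₂odd) hsdvd) hsdvd ⟨r, by rw [hsr]; ring⟩
    have hdk : d ≤ k₂ := by
      by_contra! hc
      nlinarith
    have : 3 * D.n = 2 ^ l * k₁ * k₂ + d := by rw [hn, ← hD, hgen]; ring
    linarith
end

section
/- Let n = n₁·d where n₁ ≥ 3 and d ≥ 3 are odd integers, with n₁ ≡ 0 (mod 3) and d ≢ 0 (mod 3). Then there are no integers a, b, c₁ satisfying simultaneously: gcd(a,n) = gcd(b,n) = gcd(c₁,n₁) = 1, b − a ≡ ab (mod n), and a + b + c₁·d ≡ 0 (mod n). -/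
theorem Int.not_dvd_of_gcd_eq_one {p x m : ℤ} (hp : ¬ IsUnit p) (hpm : p ∣ m)
    (h : Int.gcd x m = 1) : ¬ p ∣ x := fun hpx =>
  hp ((Int.isCoprime_iff_gcd_eq_one.mpr h).isUnit_of_dvd' hpx hpm)

/-- Two units modulo `3` with `b - a ≡ ab` have sum zero modulo `3`. -/
theorem Int.three_dvd_add_of_sub_modEq_mul {a b : ℤ} (ha : ¬ (3 : ℤ) ∣ a) (hb : ¬ (3 : ℤ) ∣ b)
    (h : b - a ≡ a * b [ZMOD 3]) : (3 : ℤ) ∣ a + b := by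
  by_contra hab
  have hsub : (3 : ℤ) ∣ b - a := by
    obtain ha | ha : a % 3 = 1 ∨ a % 3 = 2 := by omega
    all_goals obtain hb | hb : b % 3 = 1 ∨ b % 3 = 2 := by omega
    all_goals omega
  have hmul : (3 : ℤ) ∣ a * b := h.dvd_iff.mp hsub
  exact (Int.prime_three.dvd_or_dvd hmul).elim ha hb

/-- Lemma 4.2(1): if `n = n₁·d` with `n₁, d ≥ 3` odd, `3 ∣ n₁` and `3 ∤ d`,
then the system `gcd(a,n) = gcd(b,n) = gcd(c₁,n₁) = 1`, `b − a ≡ ab (mod n)`,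
`a + b + c₁·d ≡ 0 (mod n)` has no solution. -/
theorem lemma_4_2_part1 (n n₁ d : ℤ) (hn : n = n₁ * d)
    (hn₁3 : 3 ≤ n₁) (hd3 : 3 ≤ d) (hn₁odd : Odd n₁) (hdodd : Odd d)
    (h₁ : (3 : ℤ) ∣ n₁) (h₂ : ¬ (3 : ℤ) ∣ d) :
    ¬ ∃ a b c₁ : ℤ, Int.gcd a n = 1 ∧ Int.gcd b n = 1 ∧ Int.gcd c₁ n₁ = 1 ∧
      b - a ≡ a * b [ZMOD n] ∧ a + b + c₁ * d ≡ 0 [ZMOD n] := by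
  rintro ⟨a, b, c₁, ha, hb, hc, hab, hsum⟩
  have h3 : ¬ IsUnit (3 : ℤ) := Int.prime_three.not_isUnit
  have h3n : (3 : ℤ) ∣ n := hn ▸ h₁.mul_right d
  have hadd : (3 : ℤ) ∣ a + b := Int.three_dvd_add_of_sub_modEq_mul
    (Int.not_dvd_of_gcd_eq_one h3 h3n ha) (Int.not_dvd_of_gcd_eq_one h3 h3n hb) (hab.of_dvd h3n)
  have hcd : (3 : ℤ) ∣ c₁ * d :=
    (dvd_add_right hadd).mp (Int.modEq_zero_iff_dvd.mp (hsum.of_dvd h3n))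
  exact (Int.prime_three.dvd_or_dvd hcd).elim (Int.not_dvd_of_gcd_eq_one h3 h₁ hc) h₂
end

section
/- Let n = n₁·d where n₁ ≥ 3 and d ≥ 3 are odd integers, and suppose that either both n₁ ≡ 0 (mod 3) and d ≡ 0 (mod 3), or n₁ ≢ 0 (mod 3). Then there exist integers a, b, c₁ satisfying simultaneously: gcd(a,n) = gcd(b,n) = gcd(c₁,n₁) = 1, b − a ≡ ab (mod n), and a + b + c₁·d ≡ 0 (mod n). -/
/-- Coprimality of integers can be tested on prime divisors. -/
theorem Int.isCoprime_of_forall_prime_not_dvd {x y : ℤ}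
    (h : ∀ p : ℕ, p.Prime → (p : ℤ) ∣ x → ¬ (p : ℤ) ∣ y) : IsCoprime x y := by
  rw [Int.isCoprime_iff_gcd_eq_one]
  by_contra hg
  obtain ⟨p, hp, hpg⟩ := Nat.exists_prime_and_dvd hg
  exact h p hp ((Int.natCast_dvd_natCast.2 hpg).trans (Int.gcd_dvd_left ..))
    ((Int.natCast_dvd_natCast.2 hpg).trans (Int.gcd_dvd_right ..))

/-- Fermat's little theorem with the exponent `φ(m)`, for a prime `p` dividing `m`. -/
theorem Int.prime_dvd_pow_totient_sub_one {m p : ℕ} (hp : p.Prime) (hpm : p ∣ m) {d : ℤ}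
    (hpd : ¬ (p : ℤ) ∣ d) : (p : ℤ) ∣ d ^ m.totient - 1 := by
  have hcop : IsCoprime d (p : ℤ) :=
    ((Nat.prime_iff_prime_int.1 hp).coprime_iff_not_dvd.2 hpd).symm
  obtain ⟨k, hk⟩ := Nat.totient_dvd_of_dvd hpm
  rw [Nat.totient_prime hp] at hk
  have h := (Int.ModEq.pow_card_sub_one_eq_one hp hcop).pow k
  rw [← pow_mul, ← hk, one_pow] at h
  exact h.symm.dvd

/-- An odd `e` which is `-1` modulo the primes dividing both `m` and `d`, and `2 / d` modulo the
primes dividing `m` but not `d`. -/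
theorem Int.exists_odd_modEq_two_div {m d : ℤ} (hm : 3 ≤ m) (hmodd : Odd m) (hd : Odd d) :
    ∃ e : ℤ, Odd e ∧ ∀ p : ℕ, p.Prime → (p : ℤ) ∣ m →
      ((p : ℤ) ∣ d → (p : ℤ) ∣ e + 1) ∧ (¬ (p : ℤ) ∣ d → (p : ℤ) ∣ d * e - 2) := by
  obtain ⟨k, hk⟩ : ∃ k, m.natAbs.totient = k + 2 := by
    have h1 : m.natAbs.totient ≠ 0 := by
      have := Nat.totient_pos.2 (show 0 < m.natAbs by omega)
      omega
    have h2 : m.natAbs.totient ≠ 1 := by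
      rw [Ne, Nat.totient_eq_one_iff]
      omega
    exact ⟨m.natAbs.totient - 2, by omega⟩
  refine ⟨2 * d ^ (k + 1) + (d ^ (k + 2) - 1) + m, ?_,
    fun p hp hpm => ⟨fun hpd => ?_, fun hpd => ?_⟩⟩
  · exact ((even_two_mul _).add ((hd.pow).sub_odd odd_one)).add_odd hmodd
  · have h : 2 * d ^ (k + 1) + (d ^ (k + 2) - 1) + m + 1 = d * (2 * d ^ k + d ^ (k + 1)) + m := by
      ring
    rw [h]
    exact (hpd.mul_right _).add hpm
  · have h := Int.prime_dvd_pow_totient_sub_one hp (Int.natCast_dvd.1 hpm) hpd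
    rw [hk] at h
    have h' : d * (2 * d ^ (k + 1) + (d ^ (k + 2) - 1) + m) - 2 =
        (d ^ (k + 2) - 1) * (2 + d) + m * d := by ring
    rw [h']
    exact (h.mul_right _).add (hpm.mul_right _)

/-- Lemma 4.2(2): if `n = n₁·d` with `n₁, d ≥ 3` odd, and either
`3 ∣ n₁ ∧ 3 ∣ d` or `3 ∤ n₁`, then the system `gcd(a,n) = gcd(b,n) =
gcd(c₁,n₁) = 1`, `b − a ≡ ab (mod n)`, `a + b + c₁·d ≡ 0 (mod n)` has a
solution. -/
theorem lemma_4_2_part2 (n n₁ d : ℤ) (hn : n = n₁ * d)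
    (hn₁3 : 3 ≤ n₁) (hd3 : 3 ≤ d) (hn₁odd : Odd n₁) (hdodd : Odd d)
    (h : ((3 : ℤ) ∣ n₁ ∧ (3 : ℤ) ∣ d) ∨ ¬ (3 : ℤ) ∣ n₁) :
    ∃ a b c₁ : ℤ, Int.gcd a n = 1 ∧ Int.gcd b n = 1 ∧ Int.gcd c₁ n₁ = 1 ∧
      b - a ≡ a * b [ZMOD n] ∧ a + b + c₁ * d ≡ 0 [ZMOD n] := by
  obtain ⟨e, heodd, he⟩ := Int.exists_odd_modEq_two_div hn₁3 hn₁odd hdodd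
  obtain ⟨w, hw⟩ := hdodd.mul heodd
  have hp3 : ∀ p : ℕ, p.Prime → (p : ℤ) ∣ n₁ → ¬ (p : ℤ) ∣ d → ¬ (p : ℤ) ∣ 3 := by
    intro p hp hpn hpd hp3
    obtain rfl : p = 3 := (Nat.prime_dvd_prime_iff_eq hp Nat.prime_three).1 (by exact_mod_cast hp3)
    exact h.elim (fun h => hpd h.2) (fun h => h hpn)
  have hp1 : ∀ p : ℕ, p.Prime → ¬ (p : ℤ) ∣ 1 := fun p hp h =>
    (Nat.prime_iff_prime_int.1 hp).not_dvd_one h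
  have hwn : IsCoprime w n := by
    refine Int.isCoprime_of_forall_prime_not_dvd fun p hp hpw hpn => hp1 p hp ?_
    by_cases hpd : (p : ℤ) ∣ d
    · exact (by linear_combination -hw : (1 : ℤ) = d * e - w * 2) ▸
        (hpd.mul_right e).sub (hpw.mul_right 2)
    · have hpn₁ := ((Nat.prime_iff_prime_int.1 hp).dvd_or_dvd (hn ▸ hpn)).resolve_right hpd
      exact (by linear_combination hw : (1 : ℤ) = w * 2 - (d * e - 2)) ▸
        (hpw.mul_right 2).sub ((he p hp hpn₁).2 hpd)
  have hwn' : IsCoprime (w + 1) n := by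
    refine Int.isCoprime_of_forall_prime_not_dvd fun p hp hpw hpn => ?_
    by_cases hpd : (p : ℤ) ∣ d
    · exact hp1 p hp <| (by linear_combination hw : (1 : ℤ) = (w + 1) * 2 - d * e) ▸
        (hpw.mul_right 2).sub (hpd.mul_right e)
    · have hpn₁ := ((Nat.prime_iff_prime_int.1 hp).dvd_or_dvd (hn ▸ hpn)).resolve_right hpd
      exact hp3 p hp hpn₁ hpd <|
        (by linear_combination hw : (3 : ℤ) = (w + 1) * 2 - (d * e - 2)) ▸
          (hpw.mul_right 2).sub ((he p hp hpn₁).2 hpd)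
  have hen : IsCoprime e n₁ := by
    refine Int.isCoprime_of_forall_prime_not_dvd fun p hp hpe hpn₁ => hp1 p hp ?_
    by_cases hpd : (p : ℤ) ∣ d
    · exact (Int.dvd_add_right hpe).1 ((he p hp hpn₁).1 hpd)
    · have hp2 : (p : ℤ) ∣ 2 := (dvd_sub_right (hpe.mul_left d)).1 ((he p hp hpn₁).2 hpd)
      obtain ⟨t, ht⟩ := hn₁odd
      exact (Int.dvd_add_right (hp2.mul_right t)).1 (ht ▸ hpn₁)
  obtain ⟨a, x, hax⟩ := hwn'
  obtain ⟨b, y, hby⟩ := hwn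
  have han : IsCoprime a n := ⟨w + 1, x, by linear_combination hax⟩
  have hbn : IsCoprime b n := ⟨w, y, by linear_combination hby⟩
  have hn₁n : n₁ ∣ n := ⟨d, hn⟩
  refine ⟨a, b, -(e * a * b), Int.isCoprime_iff_gcd_eq_one.1 han,
    Int.isCoprime_iff_gcd_eq_one.1 hbn, Int.isCoprime_iff_gcd_eq_one.1 ?_, ?_, ?_⟩
  · exact ((hen.mul_left (han.of_isCoprime_of_dvd_right hn₁n)).mul_left
      (hbn.of_isCoprime_of_dvd_right hn₁n)).neg_left
  · exact Int.modEq_iff_dvd.2 ⟨a * y - b * x, by linear_combination b * hax - a * hby⟩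
  · exact Int.modEq_iff_dvd.2
      ⟨-(a * y + b * x), by linear_combination a * b * hw + a * hby + b * hax⟩
end

section
/- Let n ≥ 3 be an odd integer. There exist integers a, b, c₁ satisfying simultaneously gcd(a,n) = gcd(b,n) = gcd(c₁,n) = 1, b − a ≡ ab (mod n), and a + b + c₁ ≡ 0 (mod n), if and only if n ≢ 0 (mod 3). -/
/-- Lemma 4.3: for odd `n ≥ 3`, the system `gcd(a,n) = gcd(b,n) = gcd(c₁,n) = 1`,
`b − a ≡ ab (mod n)`, `a + b + c₁ ≡ 0 (mod n)` has a solution if and only if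
`n ≢ 0 (mod 3)`. -/
theorem lemma_4_3 (n : ℤ) (hn : 3 ≤ n) (hodd : Odd n) :
    (∃ a b c₁ : ℤ, Int.gcd a n = 1 ∧ Int.gcd b n = 1 ∧ Int.gcd c₁ n = 1 ∧
      b - a ≡ a * b [ZMOD n] ∧ a + b + c₁ ≡ 0 [ZMOD n]) ↔ ¬ (3 : ℤ) ∣ n := by
  constructor
  · rintro ⟨a, b, c, ha, hb, hc, hab, habc⟩ h3
    have not_dvd {x : ℤ} (hx : Int.gcd x n = 1) : ¬ (3 : ℤ) ∣ x := fun h => by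
      have := Int.dvd_coe_gcd h h3
      rw [hx] at this
      norm_num at this
    have ha3 := not_dvd ha
    have hb3 := not_dvd hb
    have hc3 := not_dvd hc
    have hsum : a + b + c ≡ 0 [ZMOD 3] := habc.of_dvd h3
    have hmul : b - a ≡ a * b [ZMOD 3] := hab.of_dvd h3
    have hbmod : b ≡ a [ZMOD 3] := by
      simp only [Int.ModEq] at hsum ⊢
      omega
    have hprod : (3 : ℤ) ∣ a * b := by
      have hdvd : (3 : ℤ) ∣ a * b - (b - a) := hmul.dvd
      have hsub : (3 : ℤ) ∣ b - a := hbmod.symm.dvd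
      simpa using dvd_add hdvd hsub
    rcases Int.prime_three.dvd_or_dvd hprod with h | h
    · exact ha3 h
    · exact hb3 h
  · intro h3
    obtain ⟨k, rfl⟩ := hodd
    obtain ⟨u, v, huv⟩ := (Int.prime_three.coprime_iff_not_dvd).2 h3
    refine ⟨k + 1, 1, -(k + 2), Int.isCoprime_iff_gcd_eq_one.1 ⟨2, -1, by ring⟩,
      Int.one_gcd, Int.isCoprime_iff_gcd_eq_one.1 ⟨-2 * u, v - u, ?_⟩,
      Int.modEq_iff_dvd.2 ⟨1, by ring⟩, ?_⟩
    · linear_combination huv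
    · ring_nf
      rfl
end

section
/- Every data set of type B of degree n and genus 2g' with g' ≥ 1 satisfies n ≤ 3g'. -/
/-- A data set of type B (degree `n`), as in Parlak–Stukow:
conditions (D1), (D2), (D3B), (D4B). -/
structure DataSetB where
  n : ℤ
  g0 : ℤ
  a : ℤ
  b : ℤ
  m : ℕ
  c : Fin m → ℤ
  ni : Fin m → ℤ
  /-- (D1): `n > 1` is odd -/
  n_gt_one : 1 < n
  n_odd : Odd n
  /-- (D1): each `nᵢ > 1` -/
  ni_gt_one : ∀ i, 1 < ni i
  /-- (D1): each `nᵢ` divides `n` -/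
  ni_dvd : ∀ i, ni i ∣ n
  /-- (D2) -/
  gcd_a : Int.gcd a n = 1
  gcd_b : Int.gcd b n = 1
  gcd_c : ∀ i, Int.gcd (c i) (ni i) = 1
  /-- (D3B): `g₀ ≥ 0` -/
  g0_nonneg : 0 ≤ g0
  /-- (D3B): `b − a = ab mod n` -/
  D3B : b - a ≡ a * b [ZMOD n]
  /-- (D4B): `a + b + Σᵢ (n/nᵢ)·cᵢ = 0 mod n` -/
  D4B : a + b + ∑ i, (n / ni i) * c i ≡ 0 [ZMOD n]

/-- The genus of a type B data set: `g = 2g₀·n + Σᵢ (n/nᵢ)(nᵢ − 1)`. -/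
def DataSetB.genus (D : DataSetB) : ℤ :=
  2 * D.g0 * D.n + ∑ i, (D.n / D.ni i) * (D.ni i - 1)

/-- An odd degree forces every cone order to be at least `3`, so each cone point
contributes at least `2n/3` to the genus. -/
theorem DataSetB.two_mul_n_le_three_mul_term (D : DataSetB) (i : Fin D.m) :
    2 * D.n ≤ 3 * ((D.n / D.ni i) * (D.ni i - 1)) := by
  obtain ⟨k, hk⟩ := D.ni_dvd i
  have hni := D.ni_gt_one i
  have hthree : 3 ≤ D.ni i := by
    by_contra! hlt
    have htwo : D.ni i = 2 := by omega
    exact (Int.not_even_iff_odd.mpr D.n_odd) (even_iff_two_dvd.mpr (htwo ▸ D.ni_dvd i))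
  have hquot : D.n / D.ni i = k := by
    rw [hk, Int.mul_ediv_cancel_left _ (by omega)]
  have hkpos : 0 < k := by
    have hn := D.n_gt_one
    exact pos_of_mul_pos_right (a := D.ni i) (by omega) (by omega)
  rw [hquot, hk]
  nlinarith

/-- Every type B data set of degree `n` and genus `2g'` with `g' ≥ 1`
satisfies `n ≤ 3g'`. -/
theorem typeB_degree_le (D : DataSetB) (g' : ℤ) (hg' : 1 ≤ g')
    (hgenus : D.genus = 2 * g') : D.n ≤ 3 * g' := by
  have hn := D.n_gt_one
  have hg0 := D.g0_nonneg
  have hterm := D.two_mul_n_le_three_mul_term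
  have hterm_nonneg : ∀ i ∈ Finset.univ, 0 ≤ (D.n / D.ni i) * (D.ni i - 1) := fun i _ => by
    linarith [hterm i]
  have hsum_nonneg := Finset.sum_nonneg hterm_nonneg
  unfold DataSetB.genus at hgenus
  rcases hg0.eq_or_lt with h0 | hpos
  · rw [← h0] at hgenus
    obtain ⟨i, hi, -⟩ := Finset.exists_ne_zero_of_sum_ne_zero
      (show ∑ i, (D.n / D.ni i) * (D.ni i - 1) ≠ 0 by omega)
    linarith [hterm i, Finset.single_le_sum hterm_nonneg hi]
  · nlinarith
end

section
/- Let g' = 2k for some odd integer k ≥ 1. Then the maximal degree among data sets of type B of genus 2g' equals (5/2)g' = 5k: there exists a data set of type B of genus 2g' and degree 5k, and every data set of type B of genus 2g' has degree n ≤ 5k. -/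
/-- A unit of the form `(tk ± 1) / 2` modulo `5k` yields a type B data set with a single cone point
of order `5`. -/
theorem exists_dataSetB_of_isCoprime {k t y : ℤ} (hk : 1 ≤ k) (hkodd : Odd k)
    (hy : 2 * y + 1 = t * k) (hy0 : IsCoprime y (5 * k)) (hy1 : IsCoprime (y + 1) (5 * k))
    (ht : IsCoprime t 5) :
    ∃ D : DataSetB, D.genus = 2 * (2 * k) ∧ D.n = 5 * k := by
  obtain ⟨b, v, hb⟩ := hy0
  obtain ⟨a, u, ha⟩ := hy1
  have hb5 : IsCoprime b (5 * k) := ⟨y, v, by linarith⟩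
  have ha5 : IsCoprime a (5 * k) := ⟨y + 1, u, by linarith⟩
  have hc : IsCoprime (-(a * b * t)) 5 :=
    ((ha5.of_mul_right_left.mul_left hb5.of_mul_right_left).mul_left ht).neg_left
  have hdiv : 5 * k / 5 = k := by omega
  refine ⟨{ n := 5 * k, g0 := 0, a := a, b := b, m := 1
            c := fun _ => -(a * b * t), ni := fun _ => 5
            n_gt_one := by linarith
            n_odd := Odd.mul (by decide) hkodd
            ni_gt_one := fun _ => by norm_num
            ni_dvd := fun _ => dvd_mul_right _ _
            gcd_a := Int.isCoprime_iff_gcd_eq_one.mp ha5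
            gcd_b := Int.isCoprime_iff_gcd_eq_one.mp hb5
            gcd_c := fun _ => Int.isCoprime_iff_gcd_eq_one.mp hc
            g0_nonneg := le_rfl
            D3B := ?_
            D4B := ?_ }, ?_, rfl⟩
  · refine Int.modEq_iff_dvd.mpr ⟨a * v - b * u, ?_⟩
    linear_combination b * ha - a * hb
  · refine Int.modEq_iff_dvd.mpr ⟨-(a * v + b * u), ?_⟩
    simp only [Finset.univ_unique, Finset.sum_const, Finset.card_singleton, one_smul, hdiv]
    linear_combination b * ha + a * hb - a * b * hy
  · simp [DataSetB.genus, hdiv]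
    ring

theorem exists_dataSetB_degree_five_mul {k : ℤ} (hk : 1 ≤ k) (hkodd : Odd k) :
    ∃ D : DataSetB, D.genus = 2 * (2 * k) ∧ D.n = 5 * k := by
  obtain ⟨t, htodd, ht, h0, h1⟩ : ∃ t : ℤ, Odd t ∧ t % 5 ≠ 0 ∧ (t * k) % 5 ≠ 1 ∧
      (t * k) % 5 ≠ 4 := by
    by_cases h : k % 5 = 1 ∨ k % 5 = 4
    · exact ⟨3, by decide, by norm_num, by omega, by omega⟩
    · exact ⟨1, by decide, by norm_num, by omega, by omega⟩
  obtain ⟨y, hy⟩ := htodd.mul hkodd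
  have coprime_five : ∀ x : ℤ, x % 5 ≠ 0 → IsCoprime x 5 := fun x hx =>
    ((Int.prime_iff_natAbs_prime.mpr (by norm_num)).coprime_iff_not_dvd.mpr
      (by omega : ¬ (5 : ℤ) ∣ x)).symm
  refine exists_dataSetB_of_isCoprime (t := t) (y := y) hk hkodd hy.symm
    (IsCoprime.mul_right (coprime_five y (by omega)) ⟨-2, t, by linarith⟩)
    (IsCoprime.mul_right (coprime_five (y + 1) (by omega)) ⟨2, -t, by linarith⟩)
    (coprime_five t ht)

namespace DataSetB

theorem odd_ni (D : DataSetB) (i : Fin D.m) : Odd (D.ni i) :=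
  (Int.odd_mul.mp (Int.ediv_mul_cancel (D.ni_dvd i) ▸ D.n_odd)).2

theorem two_mul_n_le (D : DataSetB) (i : Fin D.m) :
    2 * D.n ≤ 3 * (D.n / D.ni i * (D.ni i - 1)) := by
  have h1 := D.ni_gt_one i
  have hodd : Odd (D.ni i) := D.odd_ni i
  have h3 : 3 ≤ D.ni i := by
    obtain ⟨r, hr⟩ := hodd
    omega
  have hq : D.n / D.ni i * D.ni i = D.n := Int.ediv_mul_cancel (D.ni_dvd i)
  have hn := D.n_gt_one
  have hq0 : 0 ≤ D.n / D.ni i := Int.ediv_nonneg (by omega) (by omega)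
  nlinarith [mul_nonneg hq0 (sub_nonneg.mpr h3)]

theorem two_mul_m_mul_n_le (D : DataSetB) :
    2 * D.m * D.n ≤ 3 * ∑ i, D.n / D.ni i * (D.ni i - 1) := by
  rw [Finset.mul_sum]
  have h := Finset.card_nsmul_le_sum Finset.univ _ (2 * D.n) fun i _ => D.two_mul_n_le i
  simp only [Finset.card_univ, Fintype.card_fin, nsmul_eq_mul] at h
  linarith

theorem n_le_five_mul (D : DataSetB) {k : ℤ} (hk : 1 ≤ k) (hD : D.genus = 2 * (2 * k)) :
    D.n ≤ 5 * k := by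
  by_contra! hlt
  have hsum := D.two_mul_m_mul_n_le
  have hg := D.g0_nonneg
  unfold genus at hD
  have hm0 : (0 : ℤ) ≤ D.m := Int.natCast_nonneg _
  have hmn : 0 ≤ (D.m : ℤ) * D.n := mul_nonneg hm0 (by linarith)
  have hg0 : D.g0 = 0 := by
    by_contra h
    have : 1 ≤ D.g0 := by omega
    nlinarith
  simp only [hg0, mul_zero, zero_mul, zero_add] at hD
  have hm2 : D.m < 2 := by
    by_contra! h
    have : (2 : ℤ) ≤ D.m := by exact_mod_cast h
    nlinarith
  have hm : D.m = 1 := by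
    by_contra h
    have : IsEmpty (Fin D.m) := ⟨fun j => by have := j.isLt; omega⟩
    simp at hD
    omega
  have : Unique (Fin D.m) := hm ▸ (inferInstance : Unique (Fin 1))
  rw [Fintype.sum_unique] at hD
  generalize hi : (default : Fin D.m) = i at hD
  have h1 := D.ni_gt_one i
  have hq : D.n / D.ni i * D.ni i = D.n := Int.ediv_mul_cancel (D.ni_dvd i)
  have hq0 : 0 ≤ D.n / D.ni i := Int.ediv_nonneg (by omega) (by omega)
  have h5 : D.ni i < 5 := by
    by_contra! h
    nlinarith [mul_nonneg hq0 (sub_nonneg.mpr h)]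
  obtain ⟨r, hr⟩ := D.odd_ni i
  have h3 : D.ni i = 3 := by omega
  obtain ⟨s, hs⟩ := D.n_odd
  rw [h3] at hD hq
  omega

end DataSetB

/-- For `g' = 2k` with `k ≥ 1` odd, the maximal degree among type B data sets
of genus `2g'` is `(5/2)g' = 5k`. -/
theorem typeB_max_degree_two_k (k : ℤ) (hk : 1 ≤ k) (hkodd : Odd k) :
    (∃ D : DataSetB, D.genus = 2 * (2 * k) ∧ D.n = 5 * k) ∧
      ∀ D : DataSetB, D.genus = 2 * (2 * k) → D.n ≤ 5 * k :=
  ⟨exists_dataSetB_degree_five_mul hk hkodd, fun D hD => D.n_le_five_mul hk hD⟩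
end

section
/- Let g' = 12k for some odd integer k ≥ 1. Then the maximal degree among data sets of type B of genus 2g' equals (9/4)g' = 27k: there exists a data set of type B of genus 2g' and degree 27k, and every data set of type B of genus 2g' has degree n ≤ 27k. -/
/-- An integer congruent modulo `3 * k` to a unit modulo `3 * k` is coprime to `27 * k`. -/
theorem Int.gcd_eq_one_of_eq_add_three_mul {k x u t : ℤ} (hu : IsCoprime u (3 * k))
    (hx : x = u + 3 * k * t) : Int.gcd x (27 * k) = 1 := by
  have h : IsCoprime x (3 * k) := by
    rw [hx]
    exact hu.add_mul_left_left t
  exact Int.isCoprime_iff_gcd_eq_one.mp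
    ((h.pow_right (n := 3)).of_isCoprime_of_dvd_right ⟨k ^ 2, by ring⟩)

/-- A type B data set of degree `27 * k` with a single cone point of order `9`. -/
theorem DataSetB.exists_genus_eq_and_n_eq (k : ℤ) (hk : 1 ≤ k) (hkodd : Odd k) :
    ∃ D : DataSetB, D.genus = 2 * (12 * k) ∧ D.n = 27 * k := by
  have h3k : Odd (3 * k) := Odd.mul (by decide) hkodd
  have h2 : IsCoprime (2 : ℤ) (3 * k) := by
    obtain ⟨r, hr⟩ := h3k
    exact ⟨-r, 1, by rw [hr]; ring⟩
  have hdiv : 27 * k / 9 = 3 * k := by omega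
  refine ⟨{ n := 27 * k, g0 := 0, a := 2 + 6 * k + 18 * k ^ 2, b := -2 + 6 * k - 18 * k ^ 2,
            m := 1, c := fun _ => -4, ni := fun _ => 9,
            n_gt_one := by omega
            n_odd := Odd.mul (by decide) hkodd
            ni_gt_one := fun _ => by norm_num
            ni_dvd := fun _ => ⟨3 * k, by ring⟩
            gcd_a := Int.gcd_eq_one_of_eq_add_three_mul h2
              (show _ = 2 + 3 * k * (2 + 6 * k) by ring)
            gcd_b := Int.gcd_eq_one_of_eq_add_three_mul h2.neg_left
              (show _ = -2 + 3 * k * (2 - 6 * k) by ring)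
            gcd_c := fun _ => by decide
            g0_nonneg := le_rfl
            D3B := Int.modEq_iff_dvd.mpr ⟨-12 * k ^ 3, by ring⟩
            D4B := ?_ }, ?_, rfl⟩
  · simp only [hdiv, Fin.sum_univ_one]
    exact Int.modEq_iff_dvd.mpr ⟨0, by ring⟩
  · simp only [DataSetB.genus, hdiv, Fin.sum_univ_one]
    ring

/-- Each cone point contributes at least two thirds of the degree to the genus. -/
theorem DataSetB.two_mul_n_le_s15 (D : DataSetB) (i : Fin D.m) :
    2 * D.n ≤ 3 * (D.n / D.ni i * (D.ni i - 1)) := by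
  obtain ⟨q, hq⟩ := D.ni_dvd i
  have hn := D.n_gt_one
  have hi := D.ni_gt_one i
  have hodd : Odd (D.ni i) := Int.Odd.of_mul_left (hq ▸ D.n_odd)
  have h3 : 3 ≤ D.ni i := by
    obtain ⟨r, hr⟩ := hodd
    omega
  have hdiv : D.n / D.ni i = q := by
    rw [hq]
    exact Int.mul_ediv_cancel_left _ (by omega)
  have hqpos : 0 < q := by nlinarith
  rw [hdiv]
  nlinarith

/-- If an odd `q` satisfies `q * (r - 1) = 24 * k` with `0 < k`, then `q * r ≤ 27 * k`. -/
theorem Int.mul_le_of_odd_of_mul_sub_one_eq {q r k : ℤ} (hq : Odd q) (hqpos : 0 < q)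
    (hk : 0 < k) (h : q * (r - 1) = 24 * k) : q * r ≤ 27 * k := by
  have hcop : IsCoprime (8 : ℤ) q := by
    obtain ⟨s, hs⟩ := hq
    have h2 : IsCoprime (2 : ℤ) q := ⟨-s, 1, by rw [hs]; ring⟩
    exact h2.pow_left (m := 3)
  obtain ⟨t, ht⟩ : 8 ∣ r - 1 := hcop.dvd_of_dvd_mul_left ⟨3 * k, by rw [h]; ring⟩
  have htpos : 0 < t := by
    by_contra! hle
    nlinarith
  have hqt : q * t = 3 * k := by
    rw [ht] at h
    linarith
  have hqle : q ≤ q * t := by nlinarith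
  linarith

/-- A type B data set of genus `24 * k` has degree at most `27 * k`. -/
theorem DataSetB.n_le_of_genus_eq {k : ℤ} (hk : 1 ≤ k) (D : DataSetB)
    (hD : D.genus = 2 * (12 * k)) : D.n ≤ 27 * k := by
  by_contra! hlt
  unfold DataSetB.genus at hD
  have hn := D.n_gt_one
  have hle : (D.m : ℤ) * (2 * D.n) ≤ 3 * ∑ i, D.n / D.ni i * (D.ni i - 1) := by
    rw [Finset.mul_sum]
    simpa using Finset.card_nsmul_le_sum Finset.univ _ _ fun i _ => D.two_mul_n_le_s15 i
  have hg0 : D.g0 = 0 := by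
    have hg := D.g0_nonneg
    by_contra hne
    have hg1 : 1 ≤ D.g0 := by omega
    have hm : (0 : ℤ) ≤ D.m * (2 * D.n) := by positivity
    nlinarith
  rw [hg0] at hD
  obtain ⟨n, g0, a, b, m, c, ni, _, n_odd, ni_gt_one, ni_dvd, _, _, _, _, _, _⟩ := D
  dsimp only at hD hlt hn hle hg0
  have hm : (m : ℤ) < 2 := by
    by_contra! h2
    nlinarith
  obtain rfl | rfl : m = 0 ∨ m = 1 := by omega
  · simp at hD
    omega
  · rw [Fin.sum_univ_one] at hD
    obtain ⟨q, hq⟩ := ni_dvd 0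
    have hi := ni_gt_one 0
    have hdiv : n / ni 0 = q := by
      rw [hq]
      exact Int.mul_ediv_cancel_left _ (by omega)
    rw [hdiv] at hD
    have hqodd : Odd q := Int.Odd.of_mul_right (hq ▸ n_odd)
    have := Int.mul_le_of_odd_of_mul_sub_one_eq (r := ni 0) hqodd (by nlinarith)
      (by omega : 0 < k) (by linarith)
    linarith

/-- For `g' = 12k` with `k ≥ 1` odd, the maximal degree among type B data sets
of genus `2g'` is `(9/4)g' = 27k`. -/
theorem typeB_max_degree_twelve_k (k : ℤ) (hk : 1 ≤ k) (hkodd : Odd k) :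
    (∃ D : DataSetB, D.genus = 2 * (12 * k) ∧ D.n = 27 * k) ∧
      ∀ D : DataSetB, D.genus = 2 * (12 * k) → D.n ≤ 27 * k :=
  ⟨DataSetB.exists_genus_eq_and_n_eq k hk hkodd, DataSetB.n_le_of_genus_eq hk⟩
end

section
/- Let n ≥ 3 be an odd integer. (1) If g > (n−1)², then there exists a primary data set of type A of degree n and genus g. (2) If g = (n−1)², or if 0 < g < n, then there is no primary data set of type A of degree n and genus g. Equivalently, in terms of the genus formula for primary type A data sets: if g > (n−1)² then there exist integers g₀ ≥ 1 and m ≥ 0 with g = g₀·n + m·(n−1), and there are no such g₀, m when g = (n−1)² or 0 < g < n. -/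
theorem exists_eq_mul_add_mul_sub_one {n g : ℤ} (hn : 1 < n) (hg : (n - 1) ^ 2 < g) :
    ∃ g₀ m : ℤ, 1 ≤ g₀ ∧ 0 ≤ m ∧ g = g₀ * n + m * (n - 1) := by
  have h₀ : 0 ≤ (-g) % n := Int.emod_nonneg _ (by lia)
  have h₁ : (-g) % n < n := Int.emod_lt_of_pos _ (by lia)
  have h₂ : n * ((-g) / n) + (-g) % n = -g := Int.mul_ediv_add_emod _ _
  generalize (-g) % n = m at *
  generalize (-g) / n = q at *
  refine ⟨-q - m, m, ?_, h₀, by linear_combination h₂⟩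
  have h₃ : 0 < n * (-q - m) := by nlinarith
  exact pos_of_mul_pos_right h₃ (by lia)

theorem not_exists_eq_mul_add_mul_sub_one {n g : ℤ} (hn : 1 < n)
    (hg : g = (n - 1) ^ 2 ∨ (0 < g ∧ g < n)) :
    ¬ ∃ g₀ m : ℤ, 1 ≤ g₀ ∧ 0 ≤ m ∧ g = g₀ * n + m * (n - 1) := by
  rintro ⟨g₀, m, h₀, hm, h⟩
  rcases hg with hg | ⟨-, hg⟩
  · have hdvd : n - 1 ∣ g₀ := ⟨n - 1 - g₀ - m, by linear_combination hg - h⟩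
    have hle : n - 1 ≤ g₀ := Int.le_of_dvd (by lia) hdvd
    nlinarith [mul_nonneg hm (show 0 ≤ n - 1 by lia)]
  · nlinarith [mul_nonneg hm (show 0 ≤ n - 1 by lia)]

theorem DataSetA.genus_of_primary (D : DataSetA) (hD : ∀ i, D.ni i = D.n) :
    D.genus = D.g0 * D.n + D.m * (D.n - 1) := by
  have hn : D.n ≠ 0 := by have := D.n_gt_one; lia
  simp [DataSetA.genus, hD, Int.ediv_self hn, mul_sub]

/-- The primary data set of type A with `a = b = 2` and all `cᵢ = 1`. -/
def DataSetA.primary (n g₀ : ℤ) (m : ℕ) (hn : 1 < n) (hodd : Odd n) (hg₀ : 1 ≤ g₀) :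
    DataSetA where
  n := n
  g0 := g₀
  a := 2
  b := 2
  m := m
  c _ := 1
  ni _ := n
  n_gt_one := hn
  n_odd := hodd
  ni_gt_one _ := hn
  ni_dvd _ := dvd_rfl
  gcd_a := Int.isCoprime_iff_gcd_eq_one.mp (Int.isCoprime_two_left.mpr hodd)
  gcd_b := Int.isCoprime_iff_gcd_eq_one.mp (Int.isCoprime_two_left.mpr hodd)
  gcd_c _ := Int.one_gcd
  g0_pos := hg₀
  D3A := Or.inl rfl

/-- Theorem 5.1: for odd `n ≥ 3`, a primary (all `nᵢ = n`) type A data set of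
degree `n` and genus `g` exists if `g > (n−1)²`, and does not exist if
`g = (n−1)²` or `0 < g < n`. Equivalently, in terms of the genus formula for
primary type A data sets: such `g` are exactly of the form `g₀·n + m·(n−1)`
with `g₀ ≥ 1`, `m ≥ 0`. -/
theorem primary_typeA (n : ℤ) (hn : 3 ≤ n) (hodd : Odd n) (g : ℤ) :
    ((n - 1) ^ 2 < g →
      ∃ D : DataSetA, (∀ i, D.ni i = D.n) ∧ D.n = n ∧ D.genus = g) ∧
    ((g = (n - 1) ^ 2 ∨ (0 < g ∧ g < n)) →
      ¬ ∃ D : DataSetA, (∀ i, D.ni i = D.n) ∧ D.n = n ∧ D.genus = g) ∧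
    ((n - 1) ^ 2 < g →
      ∃ g₀ m : ℤ, 1 ≤ g₀ ∧ 0 ≤ m ∧ g = g₀ * n + m * (n - 1)) ∧
    ((g = (n - 1) ^ 2 ∨ (0 < g ∧ g < n)) →
      ¬ ∃ g₀ m : ℤ, 1 ≤ g₀ ∧ 0 ≤ m ∧ g = g₀ * n + m * (n - 1)) := by
  have hn₁ : 1 < n := by lia
  refine ⟨fun hg => ?_, fun hg => ?_, exists_eq_mul_add_mul_sub_one hn₁,
    not_exists_eq_mul_add_mul_sub_one hn₁⟩
  · obtain ⟨g₀, m, hg₀, hm, h⟩ := exists_eq_mul_add_mul_sub_one hn₁ hg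
    lift m to ℕ using hm
    refine ⟨.primary n g₀ m hn₁ hodd hg₀, fun _ => rfl, rfl, ?_⟩
    rw [DataSetA.genus_of_primary _ fun _ => rfl]
    exact h.symm
  · rintro ⟨D, hD, rfl, rfl⟩
    exact not_exists_eq_mul_add_mul_sub_one hn₁ hg
      ⟨D.g0, D.m, D.g0_pos, Int.natCast_nonneg _, D.genus_of_primary hD⟩
end

section
/- For every integer g with g = 3 or g ≥ 5, there exists a data set of type A of genus g and degree n = 3; and for every integer g' ≥ 2, there exists a data set of type B of genus 2g' and degree n = 3. -/
theorem exists_coprime_three_dvd_sum (k : ℕ) :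
    ∃ c : Fin (k + 2) → ℤ, (∀ i, Int.gcd (c i) 3 = 1) ∧ 3 ∣ ∑ i, c i := by
  obtain ⟨x, y, hx, hy, hxy⟩ :
      ∃ x y : ℤ, Int.gcd x 3 = 1 ∧ Int.gcd y 3 = 1 ∧ 3 ∣ x + y + k := by
    obtain h | h | h : k % 3 = 0 ∨ k % 3 = 1 ∨ k % 3 = 2 := by omega
    · exact ⟨1, 2, by decide, by decide, by omega⟩
    · exact ⟨1, 1, by decide, by decide, by omega⟩
    · exact ⟨2, 2, by decide, by decide, by omega⟩
  refine ⟨Fin.cons x (Fin.cons y fun _ => 1), fun i => ?_, ?_⟩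
  · refine Fin.cases hx (fun j => ?_) i
    exact Fin.cases hy (fun _ => by simp) j
  · simpa [Fin.sum_univ_succ, add_assoc] using hxy

theorem exists_dataSetA_of_degree_three (g0 : ℤ) (hg0 : 1 ≤ g0) (m : ℕ) :
    ∃ D : DataSetA, D.genus = 3 * g0 + 2 * m ∧ D.n = 3 := by
  refine ⟨{ n := 3, g0 := g0, a := 2, b := 2, m := m, c := fun _ => 1, ni := fun _ => 3,
            n_gt_one := by decide, n_odd := by decide, ni_gt_one := by simp,
            ni_dvd := by simp, gcd_a := by decide, gcd_b := by decide, gcd_c := by simp,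
            g0_pos := hg0, D3A := Or.inl (by decide) }, ?_, rfl⟩
  simp [DataSetA.genus]
  ring

theorem exists_dataSetB_of_degree_three (k : ℕ) :
    ∃ D : DataSetB, D.genus = 2 * (k + 2) ∧ D.n = 3 := by
  obtain ⟨c, hc, hsum⟩ := exists_coprime_three_dvd_sum k
  refine ⟨{ n := 3, g0 := 0, a := 2, b := 1, m := k + 2, c := c, ni := fun _ => 3,
            n_gt_one := by decide, n_odd := by decide, ni_gt_one := by simp,
            ni_dvd := by simp, gcd_a := by decide, gcd_b := by decide, gcd_c := hc,
            g0_nonneg := le_rfl, D3B := by decide,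
            D4B := Int.modEq_zero_iff_dvd.2 ?_ }, ?_, rfl⟩
  · simpa using dvd_add (dvd_refl 3) hsum
  · simp [DataSetB.genus]
    ring

/-- Corollary 5.3 (arithmetic content): whenever a nontrivial root exists,
a root of degree 3 exists. For every `g = 3` or `g ≥ 5` there is a type A
data set of genus `g` and degree 3; for every `g' ≥ 2` there is a type B
data set of genus `2g'` and degree 3. -/
theorem roots_of_degree_three :
    (∀ g : ℤ, (g = 3 ∨ 5 ≤ g) → ∃ D : DataSetA, D.genus = g ∧ D.n = 3) ∧
    (∀ g' : ℤ, 2 ≤ g' → ∃ D : DataSetB, D.genus = 2 * g' ∧ D.n = 3) := by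
  refine ⟨fun g hg => ?_, fun g' hg' => ?_⟩
  · rcases Int.even_or_odd' g with ⟨k, hk | hk⟩
    · obtain ⟨D, hD, hn⟩ := exists_dataSetA_of_degree_three 2 (by norm_num) (k - 3).toNat
      exact ⟨D, by omega, hn⟩
    · obtain ⟨D, hD, hn⟩ := exists_dataSetA_of_degree_three 1 le_rfl (k - 1).toNat
      exact ⟨D, by omega, hn⟩
  · obtain ⟨D, hD, hn⟩ := exists_dataSetB_of_degree_three (g' - 2).toNat
    exact ⟨D, by omega, hn⟩
end
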